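/- Let k be an odd integer and a an integer. A positive integer d divides a (arith k) if and only if d divides 2a and it is not the case that d is even and d divides a. -/

import Mathlib

/-- The `k`-arithmetic product: `m ⊙_k n = (m - n + 1)·n + (n·(n-1)/2)·k`.
    (`n * (n - 1)` is always even, so the integer division is exact.) -/
def kprod (k m n : ℤ) : ℤ := (m - n + 1) * n + n * (n - 1) / 2 * k

theorem kprod_two_mul (j b e : ℤ) :
    kprod (2 * j + 1) b (2 * e) = e * (2 * (b - e + 1 + (2 * e - 1) * j) - 1) := by
  have h : 2 * e * (2 * e - 1) / 2 = e * (2 * e - 1) := by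
    rw [mul_assoc, Int.mul_ediv_cancel_left _ two_ne_zero]
  rw [kprod, h]
  ring

theorem kprod_two_mul_add_one (k b e : ℤ) :
    kprod k b (2 * e + 1) = (2 * e + 1) * (b - 2 * e + e * k) := by
  have h : (2 * e + 1) * (2 * e + 1 - 1) / 2 = (2 * e + 1) * e := by
    rw [show (2 * e + 1) * (2 * e + 1 - 1) = 2 * ((2 * e + 1) * e) by ring,
      Int.mul_ediv_cancel_left _ two_ne_zero]
  rw [kprod, h]
  ring

/-- For odd `k`, a positive integer `d` divides `a` (arith `k`) iff `d ∣ 2a`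
    and it is not the case that `d` is even and `d ∣ a`. -/
theorem stmt_3 (k a : ℤ) (hk : Odd k) (d : ℤ) (hd : 0 < d) :
    (∃ b : ℤ, kprod k b d = a) ↔ (d ∣ 2 * a ∧ ¬(Even d ∧ d ∣ a)) := by
  rcases Int.even_or_odd' d with ⟨e, rfl | rfl⟩
  · obtain ⟨j, rfl⟩ := hk
    have he : e ≠ 0 := by lia
    simp only [kprod_two_mul, even_two_mul, true_and, mul_dvd_mul_iff_left (two_ne_zero (α := ℤ))]
    constructor
    · rintro ⟨b, rfl⟩
      refine ⟨dvd_mul_right _ _, ?_⟩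
      rw [mul_comm 2 e, mul_dvd_mul_iff_left he]
      lia
    · rintro ⟨⟨c, rfl⟩, hc⟩
      rw [mul_comm 2 e, mul_dvd_mul_iff_left he] at hc
      obtain ⟨t, rfl⟩ : Odd c := by
        rwa [← Int.not_even_iff_odd, even_iff_two_dvd]
      exact ⟨t + e - (2 * e - 1) * j, by ring⟩
  · have hodd : ¬ Even (2 * e + 1) := Int.not_even_two_mul_add_one e
    have hcop : IsCoprime (2 * e + 1) 2 := ⟨1, -e, by ring⟩
    have hdvd : 2 * e + 1 ∣ 2 * a ↔ 2 * e + 1 ∣ a :=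
      ⟨hcop.dvd_of_dvd_mul_left, fun h => h.mul_left 2⟩
    simp only [kprod_two_mul_add_one, hodd, false_and, not_false_eq_true, and_true, hdvd]
    constructor
    · rintro ⟨b, rfl⟩
      exact dvd_mul_right _ _
    · rintro ⟨c, rfl⟩
      exact ⟨c + 2 * e - e * k, by ring⟩
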